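/- arXiv:2601.05037 — 12 statements merged into one kernel-verified Lean document; each statement's English description precedes it below -/
import Mathlib

section
/- For all real numbers p, q, a₀, a₁, a₂, setting 𝒫 := a₀ + a₁·p + a₂·p² + a₁·p³ + a₀·p⁴ and 𝒬 := a₀ + a₁·q + a₂·q² + a₁·q³ + a₀·q⁴, the polynomial identity (1−q²)²·𝒫 − (1−p²)²·𝒬 = (p−q)·(1−pq)·[(a₂+2a₀)·(p+q)·(1+pq) + a₁·(1 + 4pq + p² + q² + p²q²)] holds. Consequently, whenever (1−q²)²𝒫 − (1−p²)²𝒬 ≠ 0 and (a₂+2a₀)(p+q)(1+pq) + a₁(1+4pq+p²+q²+p²q²) ≠ 0 and p ≠ q and 1−p²q² ≠ 0, one has (p−q)²(1−p²q²)/[(1−q²)²𝒫 − (1−p²)²𝒬] = (p−q)(1+pq)/[(a₂+2a₀)(p+q)(1+pq) + a₁(1+4pq+p²+q²+p²q²)]. -/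
theorem stmt0 (p q a₀ a₁ a₂ : ℝ) :
    let P := a₀ + a₁*p + a₂*p^2 + a₁*p^3 + a₀*p^4
    let Q := a₀ + a₁*q + a₂*q^2 + a₁*q^3 + a₀*q^4
    ((1-q^2)^2*P - (1-p^2)^2*Q
        = (p-q)*(1-p*q)*((a₂+2*a₀)*(p+q)*(1+p*q)
            + a₁*(1+4*p*q+p^2+q^2+p^2*q^2)))
    ∧ (((1-q^2)^2*P - (1-p^2)^2*Q ≠ 0) →
        ((a₂+2*a₀)*(p+q)*(1+p*q) + a₁*(1+4*p*q+p^2+q^2+p^2*q^2) ≠ 0) →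
        p ≠ q → 1-p^2*q^2 ≠ 0 →
        (p-q)^2*(1-p^2*q^2)/((1-q^2)^2*P - (1-p^2)^2*Q)
          = (p-q)*(1+p*q)/((a₂+2*a₀)*(p+q)*(1+p*q)
              + a₁*(1+4*p*q+p^2+q^2+p^2*q^2))) := by
  intro P Q
  have key : (1-q^2)^2*P - (1-p^2)^2*Q
      = (p-q)*(1-p*q)*((a₂+2*a₀)*(p+q)*(1+p*q)
          + a₁*(1+4*p*q+p^2+q^2+p^2*q^2)) := by
    simp only [P, Q]
    ring
  refine ⟨key, fun hne hD _ _ => ?_⟩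
  rw [div_eq_div_iff hne hD, key]
  ring
end

section
/- Let p, q, a₀, a₁, a₂, Δ be real numbers with p ≠ q and Δ² = (2a₀+a₂)² − 4a₁². Define 𝒫 := a₀ + a₁p + a₂p² + a₁p³ + a₀p⁴, 𝒬 := a₀ + a₁q + a₂q² + a₁q³ + a₀q⁴, ρ² := −𝒫𝒬/(p−q)⁴, Z := −[2a₀ + a₁(p+q) + pq·(2a₂ + 2a₀pq + a₁(p+q))]/(2(p−q)²), and for each sign s ∈ {+1,−1}: Z_s := (a₂ − 2a₀ + sΔ)/4, B_s := [a₁² − 2a₀(a₂+2a₀) + 2s·a₀Δ]/4, A_s := (a₁/8)·(a₂ − 6a₀ + sΔ). Then for each sign s one has the identity [A_s·(p+q) + B_s·(1+pq)]² = B_s·(p−q)²·[ρ² + (Z − Z_s)²]. -/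
theorem stmt1 (p q a₀ a₁ a₂ Δ : ℝ) (hpq : p ≠ q)
    (hΔ : Δ^2 = (2*a₀+a₂)^2 - 4*a₁^2)
    (s : ℝ) (hs : s = 1 ∨ s = -1) :
    let P := a₀ + a₁*p + a₂*p^2 + a₁*p^3 + a₀*p^4
    let Q := a₀ + a₁*q + a₂*q^2 + a₁*q^3 + a₀*q^4
    let ρ2 := -(P*Q)/(p-q)^4
    let Z := -(2*a₀ + a₁*(p+q) + p*q*(2*a₂ + 2*a₀*p*q + a₁*(p+q)))/(2*(p-q)^2)
    let Zs := (a₂ - 2*a₀ + s*Δ)/4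
    let Bs := (a₁^2 - 2*a₀*(a₂+2*a₀) + 2*s*a₀*Δ)/4
    let As := (a₁/8)*(a₂ - 6*a₀ + s*Δ)
    (As*(p+q) + Bs*(1+p*q))^2 = Bs*(p-q)^2*(ρ2 + (Z - Zs)^2) := by
  intro P Q ρ2 Z Zs Bs As
  have hR : p - q ≠ 0 := sub_ne_zero.mpr hpq
  have hs2 : s^2 = 1 := by rcases hs with rfl | rfl <;> norm_num
  have hd : (s*Δ)^2 = (2*a₀+a₂)^2 - 4*a₁^2 := by rw [mul_pow, hs2, one_mul, hΔ]
  have hBs : Bs = (a₁^2 - 2*a₀*(a₂+2*a₀) + 2*a₀*(s*Δ))/4 := by simp only [Bs]; ring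
  have hdist : ρ2 + (Z - Zs)^2 =
      ((2*a₀ + a₁*(p+q) + p*q*(2*a₂ + 2*a₀*p*q + a₁*(p+q)) + 2*(p-q)^2*Zs)^2 - 4*(P*Q))
        / (4*(p-q)^4) := by
    simp only [ρ2, Z]
    field_simp
    ring
  rw [hdist, hBs, mul_div_assoc', eq_div_iff (by positivity)]
  simp only [P, Q, Zs, As]
  generalize s*Δ = d at hd ⊢
  linear_combination
    (-(p-q)^2 * (a₀/2*(p-q)^4/4*d + (a₁^2 - 2*a₀*(a₂+2*a₀))/4*(p-q)^4/4
      + a₀/2*(2*a₀ + a₁*(p+q) + p*q*(2*a₂ + 2*a₀*p*q + a₁*(p+q))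
        + (p-q)^2*(a₂-2*a₀)/2)*(p-q)^2
      - 4*(p-q)^2*(a₁/8*(p+q) + a₀/2*(1+p*q))^2)) * hd
end

section
/- Let p, q, a₀, a₁, a₂, Δ be real numbers with p ≠ q, Δ ≠ 0 and Δ² = (2a₀+a₂)² − 4a₁², and let ℓ² := (8a₀² + a₁² − 4a₀a₂)/4 be nonzero. For each sign s ∈ {+1,−1} set Z_s := (a₂−2a₀+sΔ)/4, B_s := [a₁² − 2a₀(a₂+2a₀) + 2s·a₀Δ]/4, A_s := (a₁/8)(a₂ − 6a₀ + sΔ), and let b_s be a nonzero real number with b_s² = B_s. Define r_s := [A_s(p+q) + B_s(1+pq)]/(b_s(p−q)) and m_s := s·A_s/(b_s·ℓ²·Δ), and assume r_+ ≠ 0, r_− ≠ 0 and E := (a₂+2a₀)(p+q)(1+pq) + a₁(1+4pq+p²+q²+p²q²) ≠ 0. Then the Gibbons–Hawking potential V := (p−q)(1+pq)/(ℓ²·E) satisfies V = m_+/r_+ + m_−/r_−. -/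
theorem stmt2 (p q a₀ a₁ a₂ Δ bp bm : ℝ) (hpq : p ≠ q) (hΔ0 : Δ ≠ 0)
    (hΔ : Δ^2 = (2*a₀+a₂)^2 - 4*a₁^2)
    (hℓ0 : (8*a₀^2 + a₁^2 - 4*a₀*a₂)/4 ≠ 0)
    (hbp : bp ≠ 0) (hbm : bm ≠ 0)
    (hbpsq : bp^2 = (a₁^2 - 2*a₀*(a₂+2*a₀) + 2*a₀*Δ)/4)
    (hbmsq : bm^2 = (a₁^2 - 2*a₀*(a₂+2*a₀) - 2*a₀*Δ)/4) :
    let ℓ2 := (8*a₀^2 + a₁^2 - 4*a₀*a₂)/4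
    let Ap := (a₁/8)*(a₂ - 6*a₀ + Δ)
    let Am := (a₁/8)*(a₂ - 6*a₀ - Δ)
    let Bp := (a₁^2 - 2*a₀*(a₂+2*a₀) + 2*a₀*Δ)/4
    let Bm := (a₁^2 - 2*a₀*(a₂+2*a₀) - 2*a₀*Δ)/4
    let rp := (Ap*(p+q) + Bp*(1+p*q))/(bp*(p-q))
    let rm := (Am*(p+q) + Bm*(1+p*q))/(bm*(p-q))
    let mp := Ap/(bp*ℓ2*Δ)
    let mm := -Am/(bm*ℓ2*Δ)
    let E := (a₂+2*a₀)*(p+q)*(1+p*q) + a₁*(1+4*p*q+p^2+q^2+p^2*q^2)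
    rp ≠ 0 → rm ≠ 0 → E ≠ 0 →
    (p-q)*(1+p*q)/(ℓ2*E) = mp/rp + mm/rm := by
  intro ℓ2 Ap Am Bp Bm rp rm mp mm E hrp hrm hE
  have hℓ : ℓ2 ≠ 0 := hℓ0
  have hpq' : p - q ≠ 0 := sub_ne_zero.mpr hpq
  have hNp : Ap*(p+q) + Bp*(1+p*q) ≠ 0 := (div_ne_zero_iff.mp hrp).1
  have hNm : Am*(p+q) + Bm*(1+p*q) ≠ 0 := (div_ne_zero_iff.mp hrm).1
  have hAA : Ap*Am = a₁^2*ℓ2/4 := by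
    simp only [Ap, Am, ℓ2]
    linear_combination (-(a₁^2)/64) * hΔ
  have hBB : Bp*Bm = a₁^2*ℓ2/4 := by
    simp only [Bp, Bm, ℓ2]
    linear_combination (-(a₀^2)/4) * hΔ
  have hdiff : Ap*Bm - Am*Bp = a₁*Δ*ℓ2/4 := by
    simp only [Ap, Am, Bp, Bm, ℓ2]
    ring
  have hsum : Ap*Bm + Am*Bp = a₁*(a₂+2*a₀)*ℓ2/4 := by
    simp only [Ap, Am, Bp, Bm, ℓ2]
    linear_combination (-(a₁*a₀)/8) * hΔ
  have hE' : E = (a₂+2*a₀)*(p+q)*(1+p*q) + a₁*((p+q)^2 + (1+p*q)^2) := by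
    simp only [E]
    ring
  have hNN : (Ap*(p+q) + Bp*(1+p*q)) * (Am*(p+q) + Bm*(1+p*q)) = a₁*ℓ2/4 * E := by
    rw [hE']
    linear_combination (p+q)^2 * hAA + (1+p*q)^2 * hBB + (p+q)*(1+p*q) * hsum
  have hp : mp/rp = Ap*(p-q)/(ℓ2*Δ*(Ap*(p+q) + Bp*(1+p*q))) := by
    simp only [mp, rp]
    field_simp
  have hm : mm/rm = -Am*(p-q)/(ℓ2*Δ*(Am*(p+q) + Bm*(1+p*q))) := by
    simp only [mm, rm]
    field_simp
  rw [hp, hm, div_add_div _ _ (by positivity) (by positivity),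
    div_eq_div_iff (by positivity) (by positivity)]
  linear_combination (p-q)*(1+p*q)*ℓ2^2*Δ^2 * hNN - (p-q)*(1+p*q)*ℓ2^2*Δ*E * hdiff
end

section
/- Let a₀, a₁, c, ℓ, b₀ be real numbers with ℓ ≠ 0 and b₀ > 0. For ε > 0 define b_+(ε) := √(b₀² + 2a₀ε), b_−(ε) := √(b₀² − 2a₀ε), m_+(ε) := a₁·(ε − c)/(8ℓ²·ε·b_+(ε)), m_−(ε) := a₁·(ε + c)/(8ℓ²·ε·b_−(ε)), and for x = (x₁,x₂,x₃) ∈ ℝ³ with x ≠ 0 define V_ε(x) := m_+(ε)/√(x₁²+x₂²+(x₃−ε)²) + m_−(ε)/√(x₁²+x₂²+(x₃+ε)²). Then, as ε tends to 0 from the right, V_ε(x) converges to A/r + B·x₃/r³, where r := √(x₁²+x₂²+x₃²), A := (a₁/(4ℓ²b₀))·(1 + a₀c/b₀²) and B := −a₁·c/(4ℓ²b₀). In particular the individually divergent 1/ε contributions of the two terms cancel in the limit. -/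
open Filter Topology in
/-- A pair of poles of strengths `1 ∓ c / ε` placed symmetrically in a differentiable profile `g`
converges to a monopole term plus a dipole term. -/
theorem HasDerivAt.tendsto_symmetric_pair {g : ℝ → ℝ} {g' : ℝ} (hg : HasDerivAt g g' 0) (c : ℝ) :
    Tendsto (fun ε => (ε - c) / ε * g ε + (ε + c) / ε * g (-ε)) (𝓝[>] 0)
      (𝓝 (2 * g 0 - 2 * c * g')) := by
  have hneg : HasDerivAt (fun ε => g (-ε)) (-g') 0 := by
    simpa [Function.comp_def] using
      HasDerivAt.comp (h₂ := g) (0 : ℝ) (by simpa using hg) (hasDerivAt_neg (0 : ℝ))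
  have hle : 𝓝[>] (0 : ℝ) ≤ 𝓝[≠] 0 := nhdsWithin_mono _ fun _ h => ne_of_gt h
  have hdiff := (hasDerivAt_iff_tendsto_slope.mp (hg.sub hneg)).mono_left hle
  have hsum : Tendsto (fun ε => g ε + g (-ε)) (𝓝[>] 0) (𝓝 (g 0 + g (-0))) :=
    (hg.continuousAt.add hneg.continuousAt).tendsto.mono_left nhdsWithin_le_nhds
  have key := hsum.sub (hdiff.const_mul c)
  have hlim : g 0 + g (-0) - c * (g' - -g') = 2 * g 0 - 2 * c * g' := by
    rw [neg_zero]; ring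
  rw [hlim] at key
  refine key.congr' ?_
  filter_upwards [self_mem_nhdsWithin] with ε hε
  have hε' : ε ≠ 0 := ne_of_gt hε
  simp only [slope_def_field, Pi.sub_apply, neg_zero, sub_self, sub_zero]
  field_simp
  ring

theorem hasDerivAt_inv_sqrt_mul_sqrt {a b x s : ℝ} (hb : 0 < b) (hr : 0 < s + x ^ 2) :
    HasDerivAt (fun ε => (√(b ^ 2 + 2 * a * ε) * √(s + (x - ε) ^ 2))⁻¹)
      (x / (b * √(s + x ^ 2) ^ 3) - a / (b ^ 3 * √(s + x ^ 2))) 0 := by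
  have hbsqrt : √(b ^ 2) = b := Real.sqrt_sq hb.le
  have h₁ : HasDerivAt (fun ε : ℝ => b ^ 2 + 2 * a * ε) (2 * a) 0 := by
    simpa using ((hasDerivAt_id (0 : ℝ)).const_mul (2 * a)).const_add (b ^ 2)
  have h₂ : HasDerivAt (fun ε : ℝ => s + (x - ε) ^ 2) (-(2 * x)) 0 := by
    simpa using (((hasDerivAt_id (0 : ℝ)).const_sub x).pow 2).const_add s
  have hr' : 0 < √(s + x ^ 2) := Real.sqrt_pos.mpr hr
  have h := ((h₁.sqrt (by simpa using hb.ne')).mul (h₂.sqrt (by simpa using hr.ne'))).inv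
    (by simpa [hbsqrt] using ⟨hb.ne', hr'.ne'⟩)
  refine h.congr_deriv ?_
  simp only [Pi.mul_apply, mul_zero, add_zero, sub_zero, hbsqrt]
  field_simp
  ring

theorem stmt3 (a₀ a₁ c ℓ b₀ : ℝ) (hℓ : ℓ ≠ 0) (hb₀ : 0 < b₀)
    (x₁ x₂ x₃ : ℝ) (hx : ¬(x₁ = 0 ∧ x₂ = 0 ∧ x₃ = 0)) :
    let r := Real.sqrt (x₁^2 + x₂^2 + x₃^2)
    let A := (a₁/(4*ℓ^2*b₀))*(1 + a₀*c/b₀^2)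
    let B := -(a₁*c)/(4*ℓ^2*b₀)
    Filter.Tendsto (fun ε : ℝ =>
        (a₁*(ε - c)/(8*ℓ^2*ε*Real.sqrt (b₀^2 + 2*a₀*ε)))
            / Real.sqrt (x₁^2 + x₂^2 + (x₃ - ε)^2)
          + (a₁*(ε + c)/(8*ℓ^2*ε*Real.sqrt (b₀^2 - 2*a₀*ε)))
            / Real.sqrt (x₁^2 + x₂^2 + (x₃ + ε)^2))
      (nhdsWithin 0 (Set.Ioi 0))
      (nhds (A/r + B*x₃/r^3)) := by
  intro r A B
  have hpos : 0 < x₁ ^ 2 + x₂ ^ 2 + x₃ ^ 2 := by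
    by_contra! h
    exact hx ⟨by nlinarith [sq_nonneg x₁, sq_nonneg x₂, sq_nonneg x₃],
      by nlinarith [sq_nonneg x₁, sq_nonneg x₂, sq_nonneg x₃],
      by nlinarith [sq_nonneg x₁, sq_nonneg x₂, sq_nonneg x₃]⟩
  have hr : 0 < r := Real.sqrt_pos.mpr hpos
  have key := ((hasDerivAt_inv_sqrt_mul_sqrt (a := a₀) hb₀ hpos).tendsto_symmetric_pair
    c).const_mul (a₁ / (8 * ℓ ^ 2))
  have hlim : A / r + B * x₃ / r ^ 3 = a₁ / (8 * ℓ ^ 2) *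
      (2 * (√(b₀ ^ 2 + 2 * a₀ * 0) * √(x₁ ^ 2 + x₂ ^ 2 + (x₃ - 0) ^ 2))⁻¹
        - 2 * c * (x₃ / (b₀ * r ^ 3) - a₀ / (b₀ ^ 3 * r))) := by
    rw [mul_zero, add_zero, sub_zero, Real.sqrt_sq hb₀.le]
    change A / r + B * x₃ / r ^ 3 = a₁ / (8 * ℓ ^ 2) *
      (2 * (b₀ * r)⁻¹ - 2 * c * (x₃ / (b₀ * r ^ 3) - a₀ / (b₀ ^ 3 * r)))
    simp only [A, B]
    clear_value r
    field_simp
    ring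
  rw [hlim]
  refine key.congr fun ε => ?_
  simp only [mul_neg, sub_neg_eq_add, ← sub_eq_add_neg, div_eq_mul_inv, mul_inv]
  ring
end

section
/- Let (a, b, c) be a dual twistor quadric with associated spinor field K and vector field ξ_{αα̇}(x) = 2(b_α^{β̇} + a_{αγ}x^{γβ̇})ε_{β̇α̇}, and define the tensor field H_{αα̇ββ̇}(x) := K_{α̇β̇}(x)·a_{αβ} − (1/8)·(ξ^{γγ̇}(x) ξ_{γγ̇}(x))·ε_{αβ} ε_{α̇β̇}, where ξ^{γγ̇} = ε^{γδ}ε^{γ̇δ̇}ξ_{δδ̇}. Then H is symmetric under exchange of its two index pairs (αα̇) ↔ (ββ̇), and H satisfies the rank-two Killing tensor equation of the flat metric: for all x and all indices, ∂_{αα̇} H_{ββ̇γγ̇} + ∂_{ββ̇} H_{γγ̇αα̇} + ∂_{γγ̇} H_{αα̇ββ̇} = 0. -/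
noncomputable section

open Complex

/-- Complexified Minkowski space as 2×2 complex matrices `x^{αα̇}`. -/
abbrev Sp : Type := Fin 2 → Fin 2 → ℂ

/-- The spinor epsilon symbol, `ε_{01} = ε^{01} = 1`. -/
def eps : Fin 2 → Fin 2 → ℂ := fun i j => if i = j then 0 else if i = 0 then 1 else -1

/-- Partial derivative `∂_{αα̇}` of a function on spacetime. -/
def pd (i i' : Fin 2) (f : Sp → ℂ) (x : Sp) : ℂ :=
  fderiv ℂ f x (Pi.single i (Pi.single i' 1))

/-- The spinor field `K^{α̇β̇}(x)` associated to a dual twistor quadric `(a, b, c)`. -/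
def Kup (a b c : Fin 2 → Fin 2 → ℂ) (x : Sp) (i' j' : Fin 2) : ℂ :=
  (∑ i, ∑ j, a i j * x i i' * x j j') +
    (∑ j, (b j i' * x j j' + b j j' * x j i')) + c i' j'

/-- `K_{α̇β̇} = K^{γ̇δ̇} ε_{γ̇α̇} ε_{δ̇β̇}`. -/
def Klow (a b c : Fin 2 → Fin 2 → ℂ) (x : Sp) (i' j' : Fin 2) : ℂ :=
  ∑ k', ∑ l', Kup a b c x k' l' * eps k' i' * eps l' j'

/-- `ξ_{αα̇}(x) = 2 (b_α^{β̇} + a_{αγ} x^{γβ̇}) ε_{β̇α̇}`. -/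
def xiLow (a b : Fin 2 → Fin 2 → ℂ) (x : Sp) (i i' : Fin 2) : ℂ :=
  2 * ∑ j', (b i j' + ∑ k, a i k * x k j') * eps j' i'

/-- `ξ^{αα̇} = ε^{αβ} ε^{α̇β̇} ξ_{ββ̇}`. -/
def xiUp (a b : Fin 2 → Fin 2 → ℂ) (x : Sp) (i i' : Fin 2) : ℂ :=
  ∑ j, ∑ j', eps i j * eps i' j' * xiLow a b x j j'

/-- `ξ^{γγ̇} ξ_{γγ̇}`. -/
def xiSq (a b : Fin 2 → Fin 2 → ℂ) (x : Sp) : ℂ :=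
  ∑ i, ∑ i', xiUp a b x i i' * xiLow a b x i i'

/-- `H_{αα̇ββ̇} = K_{α̇β̇} a_{αβ} - (1/8)(ξ·ξ) ε_{αβ} ε_{α̇β̇}`. -/
def Hten (a b c : Fin 2 → Fin 2 → ℂ) (x : Sp) (i i' j j' : Fin 2) : ℂ :=
  Klow a b c x i' j' * a i j - (1/8) * xiSq a b x * eps i j * eps i' j'

/-- `t_{αα̇} = H_{αα̇ββ̇} ξ^{ββ̇}`. -/
def tLow (a b c : Fin 2 → Fin 2 → ℂ) (x : Sp) (i i' : Fin 2) : ℂ :=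
  ∑ j, ∑ j', Hten a b c x i i' j j' * xiUp a b x j j'

/-- `t^{αα̇} = ε^{αβ} ε^{α̇β̇} t_{ββ̇}`. -/
def tUp (a b c : Fin 2 → Fin 2 → ℂ) (x : Sp) (i i' : Fin 2) : ℂ :=
  ∑ j, ∑ j', eps i j * eps i' j' * tLow a b c x j j'

/-- Lowering a dotted spinor: `v_{α̇} = v^{β̇} ε_{β̇α̇}`. -/
def lo (v : Fin 2 → ℂ) (i' : Fin 2) : ℂ := ∑ j', v j' * eps j' i'

/-- The null self-dual Maxwell field `φ_{α̇β̇}` produced by a dual twistor quadric. -/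
def phiF (a b : Fin 2 → Fin 2 → ℂ) (o : Fin 2 → ℂ) (κ : ℂ)
    (αf βf : Sp → Fin 2 → ℂ) (x : Sp) (i' j' : Fin 2) : ℂ :=
  -I * κ * lo (αf x) i' * lo (αf x) j' /
    ((∑ k', lo (αf x) k' * βf x k') *
      (∑ k, ∑ k', o k * lo (αf x) k' * xiUp a b x k k') ^ 2)

theorem pd_add {f g : Sp → ℂ} {x : Sp} (i i' : Fin 2) (hf : DifferentiableAt ℂ f x)
    (hg : DifferentiableAt ℂ g x) :
    pd i i' (fun y => f y + g y) x = pd i i' f x + pd i i' g x := by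
  simp [pd, fderiv_fun_add hf hg]

theorem pd_sub {f g : Sp → ℂ} {x : Sp} (i i' : Fin 2) (hf : DifferentiableAt ℂ f x)
    (hg : DifferentiableAt ℂ g x) :
    pd i i' (fun y => f y - g y) x = pd i i' f x - pd i i' g x := by
  simp [pd, fderiv_fun_sub hf hg]

theorem pd_mul {f g : Sp → ℂ} {x : Sp} (i i' : Fin 2) (hf : DifferentiableAt ℂ f x)
    (hg : DifferentiableAt ℂ g x) :
    pd i i' (fun y => f y * g y) x = f x * pd i i' g x + pd i i' f x * g x := by
  simp [pd, fderiv_fun_mul hf hg, mul_comm]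

theorem pd_const (i i' : Fin 2) (r : ℂ) (x : Sp) : pd i i' (fun _ => r) x = 0 := by
  simp [pd]

theorem pd_coord (i i' j j' : Fin 2) (x : Sp) :
    pd i i' (fun y => y j j') x = if j = i ∧ j' = i' then 1 else 0 := by
  have h : HasFDerivAt (fun y : Sp => y j j') _ x :=
    ((ContinuousLinearMap.proj (R := ℂ) (φ := fun _ : Fin 2 => ℂ) j').comp
      (ContinuousLinearMap.proj (R := ℂ) (φ := fun _ : Fin 2 => Fin 2 → ℂ) j)).hasFDerivAt
  rw [pd, h.fderiv]
  by_cases hj : j = i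
  · subst hj
    simp [Pi.single_apply]
  · simp [hj]

theorem differentiable_xiLow (a b : Fin 2 → Fin 2 → ℂ) (j j' : Fin 2) :
    Differentiable ℂ (fun y => xiLow a b y j j') := by
  unfold xiLow
  fun_prop

theorem differentiable_Klow (a b c : Fin 2 → Fin 2 → ℂ) (j' k' : Fin 2) :
    Differentiable ℂ (fun y => Klow a b c y j' k') := by
  unfold Klow Kup
  fun_prop

theorem differentiable_xiSq (a b : Fin 2 → Fin 2 → ℂ) : Differentiable ℂ (xiSq a b) := by
  have := differentiable_xiLow a b
  unfold xiSq xiUp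
  fun_prop

theorem Klow_comm (a b : Fin 2 → Fin 2 → ℂ) {c : Fin 2 → Fin 2 → ℂ}
    (ha : ∀ i j, a i j = a j i) (hc : ∀ i' j', c i' j' = c j' i') (x : Sp) (i' j' : Fin 2) :
    Klow a b c x i' j' = Klow a b c x j' i' := by
  fin_cases i' <;> fin_cases j' <;>
    simp [Klow, Kup, Fin.sum_univ_two, eps, ha 1 0, hc 1 0] <;> ring

theorem Hten_swap (a b : Fin 2 → Fin 2 → ℂ) {c : Fin 2 → Fin 2 → ℂ}
    (ha : ∀ i j, a i j = a j i) (hc : ∀ i' j', c i' j' = c j' i') (x : Sp)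
    (i i' j j' : Fin 2) : Hten a b c x i i' j j' = Hten a b c x j j' i i' := by
  have heps (k l : Fin 2) : eps k l = -eps l k := by
    fin_cases k <;> fin_cases l <;> simp [eps]
  rw [Hten, Hten, Klow_comm a b ha hc x i' j', ha i j, heps i j, heps i' j']
  ring

theorem pd_xiLow (a b : Fin 2 → Fin 2 → ℂ) (x : Sp) (i i' j j' : Fin 2) :
    pd i i' (fun y => xiLow a b y j j') x = 2 * a j i * eps i' j' := by
  simp (disch := fun_prop) only [xiLow, Fin.sum_univ_two, pd_add, pd_mul, pd_const, pd_coord]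
  fin_cases i <;> fin_cases i' <;> simp <;> ring

/-- In index-free form, `ξ^{γγ̇} ξ_{γγ̇} = 2 det ξ`. -/
theorem xiSq_eq_det (a b : Fin 2 → Fin 2 → ℂ) (x : Sp) :
    xiSq a b x = 2 * (xiLow a b x 0 0 * xiLow a b x 1 1 - xiLow a b x 0 1 * xiLow a b x 1 0) := by
  simp [xiSq, xiUp, Fin.sum_univ_two, eps]
  ring

theorem pd_xiSq (a b : Fin 2 → Fin 2 → ℂ) (x : Sp) (i i' : Fin 2) :
    pd i i' (xiSq a b) x = 4 * (a 1 i * xiLow a b x 0 i' - a 0 i * xiLow a b x 1 i') := by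
  have := differentiable_xiLow a b
  rw [funext (xiSq_eq_det a b)]
  simp (disch := fun_prop) only [pd_sub, pd_mul, pd_const, pd_xiLow]
  fin_cases i' <;> simp [eps] <;> ring

/-- The twistor equation for `K`: `∂_{αα̇} K_{β̇γ̇} = ε_{α̇(β̇} ξ_{|α|γ̇)}`. -/
theorem pd_Klow {a : Fin 2 → Fin 2 → ℂ} (b c : Fin 2 → Fin 2 → ℂ)
    (ha : ∀ i j, a i j = a j i) (x : Sp) (i i' j' k' : Fin 2) :
    pd i i' (fun y => Klow a b c y j' k') x =
      (eps i' j' * xiLow a b x i k' + eps i' k' * xiLow a b x i j') / 2 := by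
  simp (disch := fun_prop) only [Klow, Kup, xiLow, Fin.sum_univ_two, pd_add, pd_mul, pd_const,
    pd_coord]
  fin_cases i <;> fin_cases i' <;> simp [ha 1 0] <;> ring

theorem pd_Hten {a : Fin 2 → Fin 2 → ℂ} (b c : Fin 2 → Fin 2 → ℂ)
    (ha : ∀ i j, a i j = a j i) (x : Sp) (i i' j j' k k' : Fin 2) :
    pd i i' (fun y => Hten a b c y j j' k k') x =
      (eps i' j' * xiLow a b x i k' + eps i' k' * xiLow a b x i j') / 2 * a j k -
        (a 1 i * xiLow a b x 0 i' - a 0 i * xiLow a b x 1 i') / 2 * eps j k * eps j' k' := by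
  have := differentiable_Klow a b c
  have := differentiable_xiSq a b
  simp (disch := fun_prop) only [Hten, pd_sub, pd_mul, pd_const]
  rw [pd_Klow b c ha, show pd i i' (fun y => xiSq a b y) x = _ from pd_xiSq a b x i i']
  ring

theorem stmt6 (a b c : Fin 2 → Fin 2 → ℂ)
    (ha : ∀ i j, a i j = a j i) (hc : ∀ i' j', c i' j' = c j' i') :
    (∀ (x : Sp) (i i' j j' : Fin 2),
        Hten a b c x i i' j j' = Hten a b c x j j' i i') ∧
    (∀ (x : Sp) (i i' j j' k k' : Fin 2),
        pd i i' (fun y => Hten a b c y j j' k k') x +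
          pd j j' (fun y => Hten a b c y k k' i i') x +
          pd k k' (fun y => Hten a b c y i i' j j') x = 0) := by
  refine ⟨Hten_swap a b ha hc, fun x i i' j j' k k' => ?_⟩
  simp only [pd_Hten b c ha]
  fin_cases i <;> fin_cases j <;> fin_cases k <;>
    fin_cases i' <;> fin_cases j' <;> fin_cases k' <;>
    simp [eps, ha 1 0] <;> ring
end
end

section
/- Let (a, b, c) be a dual twistor quadric with associated ξ_{αα̇}(x) = 2(b_α^{β̇} + a_{αγ}x^{γβ̇})ε_{β̇α̇} and H_{αα̇ββ̇}(x) = K_{α̇β̇}(x)a_{αβ} − (1/8)(ξ^{γγ̇}ξ_{γγ̇})ε_{αβ}ε_{α̇β̇}, and define the vector field t_{αα̇}(x) := H_{αα̇ββ̇}(x) ξ^{ββ̇}(x). Then: (i) t satisfies the Killing equation of the flat metric, ∂_{αα̇} t_{ββ̇} + ∂_{ββ̇} t_{αα̇} = 0; (ii) t is a self-dual Killing vector: for each x there exists a symmetric s_{α̇β̇}(x) such that ∂_{αα̇} t_{ββ̇}(x) = ε_{αβ} s_{α̇β̇}(x); and (iii) t commutes with ξ as a vector field: t^{ββ̇} ∂_{ββ̇}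 ξ^{αα̇} − ξ^{ββ̇} ∂_{ββ̇} t^{αα̇} = 0 for all x and all α, α̇. -/
noncomputable section

open Complex

/-- The partial derivatives of an affine function are its linear coefficients. -/
lemma pd_affine (k : ℂ) (m : Fin 2 → Fin 2 → ℂ) (f : Sp → ℂ)
    (hf : ∀ y, f y = k + ∑ j, ∑ j', m j j' * y j j') (i i' : Fin 2) (x : Sp) :
    pd i i' f x = m i i' := by
  let L : Sp →ₗ[ℂ] ℂ :=
    { toFun := fun y => ∑ j, ∑ j', m j j' * y j j'
      map_add' := fun y z => by simp [Fin.sum_univ_two]; ring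
      map_smul' := fun r y => by simp [Fin.sum_univ_two]; ring }
  have h : HasFDerivAt f (LinearMap.toContinuousLinearMap L) x := by
    rw [show f = fun y => k + LinearMap.toContinuousLinearMap L y from funext hf]
    exact (LinearMap.toContinuousLinearMap L).hasFDerivAt.const_add k
  rw [pd, h.fderiv]
  change ∑ j, ∑ j', m j j' * (Pi.single i (Pi.single i' 1) : Sp) j j' = m i i'
  fin_cases i <;> fin_cases i' <;> simp [Fin.sum_univ_two]

/-- The spinor `adj(a) b b - det(a) c` with raised indices. -/
def discUp (a b c : Fin 2 → Fin 2 → ℂ) (i' j' : Fin 2) : ℂ :=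
  a 1 1 * b 0 i' * b 0 j' + a 0 0 * b 1 i' * b 1 j'
    - a 0 1 * (b 0 i' * b 1 j' + b 1 i' * b 0 j')
    - c i' j' * (a 0 0 * a 1 1 - a 0 1 * a 0 1)

/-- The gradient of the Killing vector `t`, up to the factor `ε_{αβ}`. -/
def tGrad (a b c : Fin 2 → Fin 2 → ℂ) (i' j' : Fin 2) : ℂ :=
  2 * ∑ k', ∑ l', discUp a b c k' l' * eps k' i' * eps l' j'

lemma tGrad_symm (a b c : Fin 2 → Fin 2 → ℂ) (hc : ∀ i' j', c i' j' = c j' i') (i' j' : Fin 2) :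
    tGrad a b c i' j' = tGrad a b c j' i' := by
  have hc' := hc 1 0
  fin_cases i' <;> fin_cases j' <;>
    simp [tGrad, discUp, eps, Fin.sum_univ_two, hc'] <;> ring

/-- The cubic and quadratic terms of `t` cancel, leaving an affine field. -/
lemma tLow_affine (a b c : Fin 2 → Fin 2 → ℂ)
    (ha : ∀ i j, a i j = a j i) (hc : ∀ i' j', c i' j' = c j' i') (x : Sp) (i i' : Fin 2) :
    tLow a b c x i i' =
      tLow a b c 0 i i' + ∑ j, ∑ j', (eps j i * tGrad a b c j' i') * x j j' := by
  have ha' := ha 1 0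
  have hc' := hc 1 0
  fin_cases i <;> fin_cases i' <;>
    simp [tLow, Hten, xiSq, xiUp, xiLow, Klow, Kup, tGrad, discUp, eps, Fin.sum_univ_two,
      ha', hc'] <;> ring

lemma pd_tLow (a b c : Fin 2 → Fin 2 → ℂ)
    (ha : ∀ i j, a i j = a j i) (hc : ∀ i' j', c i' j' = c j' i') (x : Sp) (i i' j j' : Fin 2) :
    pd i i' (fun y => tLow a b c y j j') x = eps i j * tGrad a b c i' j' :=
  pd_affine _ (fun i i' => eps i j * tGrad a b c i' j') _
    (fun y => tLow_affine a b c ha hc y j j') i i' x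

lemma pd_tUp (a b c : Fin 2 → Fin 2 → ℂ)
    (ha : ∀ i j, a i j = a j i) (hc : ∀ i' j', c i' j' = c j' i') (x : Sp) (i i' j j' : Fin 2) :
    pd i i' (fun y => tUp a b c y j j') x =
      ∑ l, ∑ l', eps j l * eps j' l' * (eps i l * tGrad a b c i' l') := by
  refine pd_affine (tUp a b c 0 j j')
    (fun i i' => ∑ l, ∑ l', eps j l * eps j' l' * (eps i l * tGrad a b c i' l')) _
    (fun y => ?_) i i' x
  simp only [tUp, tLow_affine a b c ha hc y, Fin.sum_univ_two]
  ring

lemma pd_xiUp (a b : Fin 2 → Fin 2 → ℂ) (x : Sp) (i i' j j' : Fin 2) :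
    pd i i' (fun y => xiUp a b y j j') x =
      ∑ l, ∑ l', eps j l * eps j' l' * (2 * a l i * eps i' l') := by
  refine pd_affine (xiUp a b 0 j j')
    (fun i i' => ∑ l, ∑ l', eps j l * eps j' l' * (2 * a l i * eps i' l')) _
    (fun y => ?_) i i' x
  simp only [xiUp, xiLow, Fin.sum_univ_two, Pi.zero_apply]
  ring

theorem stmt7 (a b c : Fin 2 → Fin 2 → ℂ)
    (ha : ∀ i j, a i j = a j i) (hc : ∀ i' j', c i' j' = c j' i') :
    (∀ (x : Sp) (i i' j j' : Fin 2),
        pd i i' (fun y => tLow a b c y j j') x +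
          pd j j' (fun y => tLow a b c y i i') x = 0) ∧
    (∀ x : Sp, ∃ s : Fin 2 → Fin 2 → ℂ, (∀ i' j', s i' j' = s j' i') ∧
        ∀ (i i' j j' : Fin 2),
          pd i i' (fun y => tLow a b c y j j') x = eps i j * s i' j') ∧
    (∀ (x : Sp) (i i' : Fin 2),
        (∑ j, ∑ j', tUp a b c x j j' * pd j j' (fun y => xiUp a b y i i') x) -
          (∑ j, ∑ j', xiUp a b x j j' * pd j j' (fun y => tUp a b c y i i') x) = 0) := by
  refine ⟨fun x i i' j j' => ?_, fun x => ⟨tGrad a b c, tGrad_symm a b c hc,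
    pd_tLow a b c ha hc x⟩, fun x i i' => ?_⟩
  · rw [pd_tLow a b c ha hc, pd_tLow a b c ha hc, tGrad_symm a b c hc j' i']
    fin_cases i <;> fin_cases j <;> simp [eps]
  · simp only [pd_tUp a b c ha hc, pd_xiUp]
    have ha' := ha 1 0
    have hc' := hc 1 0
    simp only [tUp, tLow_affine a b c ha hc x]
    fin_cases i <;> fin_cases i' <;>
      simp [tLow, Hten, xiSq, xiUp, xiLow, Klow, Kup, tGrad, discUp, eps, Fin.sum_univ_two,
        ha', hc'] <;> ring
end
end

section
/- Let (a, b, c) be a dual twistor quadric with b = 0 (so K^{α̇β̇}(x) = a_{αβ}x^{αα̇}x^{ββ̇} + c^{α̇β̇}), let ξ_{αα̇}(x) = 2 a_{αγ} x^{γβ̇} ε_{β̇α̇}, H_{αα̇ββ̇}(x) = K_{α̇β̇}(x)a_{αβ} − (1/8)(ξ^{γγ̇}ξ_{γγ̇})ε_{αβ}ε_{α̇β̇}, and t_{αα̇}(x) = H_{αα̇ββ̇}(x)ξ^{ββ̇}(x). Then t is the linear vector field t^{αα̇}(x) = −2·det(a)·c^{α̇}_{β̇}·x^{αβ̇}, where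 det(a) = a_{00}a_{11} − a_{01}a_{10} and c^{α̇}_{β̇} := c^{α̇γ̇} ε_{γ̇β̇}. In particular, when a_{αβ} = i·a·(o_α ι_β + ι_α o_β) for a scalar a and a dyad with ι^α o_α = 1, one has det(a) = a² and t^{αα̇} = −2a²·c^{α̇}_{β̇}·x^{αβ̇}. -/
noncomputable section

open Complex

theorem tUp_eq_linear (a c : Fin 2 → Fin 2 → ℂ)
    (ha : ∀ i j, a i j = a j i) (hc : ∀ i' j', c i' j' = c j' i') (x : Sp) (i i' : Fin 2) :
    tUp a (fun _ _ => 0) c x i i' =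
      -2 * (a 0 0 * a 1 1 - a 0 1 * a 1 0) * ∑ j', (∑ k', c i' k' * eps k' j') * x i j' := by
  have h1 := ha 1 0
  have h2 := hc 1 0
  fin_cases i <;> fin_cases i' <;>
    simp [tUp, tLow, Hten, xiSq, xiUp, xiLow, Klow, Kup, eps, Fin.sum_univ_two, h1, h2] <;>
    ring

theorem det_of_dyad (a : Fin 2 → Fin 2 → ℂ) (s : ℂ) (o ι : Fin 2 → ℂ)
    (hd : (∑ i, (∑ j, eps i j * ι j) * o i) = 1)
    (h : ∀ i j, a i j = I * s * (o i * ι j + ι i * o j)) :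
    a 0 0 * a 1 1 - a 0 1 * a 1 0 = s ^ 2 := by
  simp [eps, Fin.sum_univ_two] at hd
  simp only [h]
  linear_combination (s ^ 2 * (2 * o 0 * ι 0 * (2 * o 1 * ι 1) - (o 0 * ι 1 + ι 0 * o 1) ^ 2)) * I_sq
    + s ^ 2 * (ι 1 * o 0 - ι 0 * o 1 + 1) * hd

theorem stmt8 (a c : Fin 2 → Fin 2 → ℂ)
    (ha : ∀ i j, a i j = a j i) (hc : ∀ i' j', c i' j' = c j' i') :
    let b : Fin 2 → Fin 2 → ℂ := fun _ _ => 0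
    let deta : ℂ := a 0 0 * a 1 1 - a 0 1 * a 1 0
    let clow : Fin 2 → Fin 2 → ℂ := fun i' j' => ∑ k', c i' k' * eps k' j'
    (∀ (x : Sp) (i i' : Fin 2),
        tUp a b c x i i' = -2 * deta * ∑ j', clow i' j' * x i j') ∧
    (∀ (s : ℂ) (o ι : Fin 2 → ℂ),
        (∑ i, (∑ j, eps i j * ι j) * o i) = 1 →
        (∀ i j, a i j = I * s * (o i * ι j + ι i * o j)) →
        deta = s^2 ∧
        ∀ (x : Sp) (i i' : Fin 2),
          tUp a b c x i i' = -2 * s^2 * ∑ j', clow i' j' * x i j') := by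
  intro b deta clow
  have hlin := tUp_eq_linear a c ha hc
  refine ⟨hlin, fun s o ι hd h => ?_⟩
  have hdet := det_of_dyad a s o ι hd h
  exact ⟨hdet, fun x i i' => hdet ▸ hlin x i i'⟩
end
end

section
/- Let (a, b, c) be a dual twistor quadric with associated spinor field K and vector field ξ_{αα̇}(x) = 2(b_α^{β̇} + a_{αγ}x^{γβ̇})ε_{β̇α̇}, let o = (o_α) be a nonzero constant spinor and κ ∈ ℂ. Let U be an open subset of complexified Minkowski space on which there exist holomorphic (complex-differentiable) functions α, β : U → ℂ² with K^{α̇β̇}(x) = (1/2)(α^{α̇}(x)β^{β̇}(x) + α^{β̇}(x)β^{α̇}(x)), α_{γ̇}(x)β^{γ̇}(x) ≠ 0, and o_γ α_{δ̇}(x) ξ^{γδ̇}(x) ≠ 0 for all x ∈ U. Define φ_{α̇β̇}(x) := −iκ·α_{α̇}(x)α_{β̇}(x) / [(α_{γ̇}(x)β^{γ̇}(x))·(o_γ α_{δ̇}(x) ξ^{γδ̇}(x))²]. Then φ is a null self-dual Maxwell field on U: it satisfies the zero-rest-mass equation ε^{α̇γ̇} ∂_{γγ̇} φ_{α̇β̇}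 = 0 for all γ, β̇ at every point of U, and it is null, φ^{α̇β̇} φ_{α̇β̇} = 0 on U. -/
noncomputable section

open Complex

/-- The coordinate line through `x` in the direction `(k, k')`. -/
def coordLine (x : Sp) (k k' : Fin 2) (t : ℂ) : Sp :=
  x + t • (Pi.single k (Pi.single k' 1) : Sp)

lemma coordLine_zero (x : Sp) (k k' : Fin 2) : coordLine x k k' 0 = x := by
  simp [coordLine]

lemma coordLine_apply (x : Sp) (k k' : Fin 2) (t : ℂ) (i i' : Fin 2) :
    coordLine x k k' t i i' = x i i' + t * if i = k ∧ i' = k' then 1 else 0 := by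
  fin_cases k <;> fin_cases k' <;> fin_cases i <;> fin_cases i' <;> simp [coordLine]

lemma hasDerivAt_coordLine (x : Sp) (k k' : Fin 2) :
    HasDerivAt (coordLine x k k') (Pi.single k (Pi.single k' 1)) 0 := by
  have h := ((hasDerivAt_id (0 : ℂ)).smul_const
    (Pi.single k (Pi.single k' 1) : Sp)).const_add x
  rw [one_smul] at h
  exact h

/-- `pd` is the derivative along coordinate lines. -/
lemma hasDerivAt_comp_coordLine {f : Sp → ℂ} {x : Sp} (hf : DifferentiableAt ℂ f x)
    (k k' : Fin 2) : HasDerivAt (fun t => f (coordLine x k k' t)) (pd k k' f x) 0 := by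
  have hx : HasFDerivAt f (fderiv ℂ f x) (coordLine x k k' 0) := by
    rw [coordLine_zero]
    exact hf.hasFDerivAt
  exact hx.comp_hasDerivAt 0 (hasDerivAt_coordLine x k k')

/-- The field `M_i^{i'} = b_i^{i'} + a_{ik} x^{ki'}`, which is `ξ_{ii'} / 2` with the dotted index
raised. -/
def quadM (a b : Fin 2 → Fin 2 → ℂ) (x : Sp) (i i' : Fin 2) : ℂ :=
  b i i' + ∑ k, a i k * x k i'

lemma hasDerivAt_coord (x : Sp) (k k' i i' : Fin 2) :
    HasDerivAt (fun t => coordLine x k k' t i i') (if i = k ∧ i' = k' then 1 else 0) 0 := by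
  simp only [coordLine_apply]
  simpa using ((hasDerivAt_id (0 : ℂ)).mul_const
    (if i = k ∧ i' = k' then (1 : ℂ) else 0)).const_add (x i i')

lemma hasDerivAt_quadM (a b : Fin 2 → Fin 2 → ℂ) (x : Sp) (k k' i i' : Fin 2) :
    HasDerivAt (fun t => quadM a b (coordLine x k k' t) i i')
      (if i' = k' then a i k else 0) 0 := by
  simp only [quadM, Fin.sum_univ_two]
  refine ((((hasDerivAt_coord x k k' 0 i').const_mul (a i 0)).fun_add
    ((hasDerivAt_coord x k k' 1 i').const_mul (a i 1))).const_add (b i i')).congr_deriv ?_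
  fin_cases k <;> simp

lemma hasDerivAt_Kup {a : Fin 2 → Fin 2 → ℂ} (ha : ∀ i j, a i j = a j i)
    (b c : Fin 2 → Fin 2 → ℂ) (x : Sp) (k k' i' j' : Fin 2) :
    HasDerivAt (fun t => Kup a b c (coordLine x k k' t) i' j')
      ((if j' = k' then quadM a b x k i' else 0) + if i' = k' then quadM a b x k j' else 0) 0 := by
  have hx := hasDerivAt_coord x k k'
  have hS := fun i j => ((hx i i').const_mul (a i j)).fun_mul (hx j j')
  have hL := fun j => ((hx j j').const_mul (b j i')).fun_add ((hx j i').const_mul (b j j'))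
  simp only [Kup, Fin.sum_univ_two]
  refine (((((hS 0 0).fun_add (hS 0 1)).fun_add ((hS 1 0).fun_add (hS 1 1))).fun_add
    ((hL 0).fun_add (hL 1))).add_const (c i' j')).congr_deriv ?_
  have h01 := ha 0 1
  rw [coordLine_zero]
  fin_cases k <;> fin_cases k' <;> fin_cases i' <;> fin_cases j' <;>
    simp [quadM, Fin.sum_univ_two, h01] <;> ring

lemma lo_zero (v : Fin 2 → ℂ) : lo v 0 = -v 1 := by
  simp [lo, eps]

lemma lo_one (v : Fin 2 → ℂ) : lo v 1 = v 0 := by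
  simp [lo, eps]

lemma sum_lo_mul (v w : Fin 2 → ℂ) : ∑ k', lo v k' * w k' = v 0 * w 1 - v 1 * w 0 := by
  simp only [Fin.sum_univ_two, lo_zero, lo_one]
  ring

/-- The spinor `o_i ε^{ij} M_j^{i'}`. -/
def oM (a b : Fin 2 → Fin 2 → ℂ) (o : Fin 2 → ℂ) (x : Sp) (i' : Fin 2) : ℂ :=
  o 0 * quadM a b x 1 i' - o 1 * quadM a b x 0 i'

lemma sum_o_lo_xiUp (a b : Fin 2 → Fin 2 → ℂ) (o v : Fin 2 → ℂ) (x : Sp) :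
    ∑ k, ∑ k', o k * lo v k' * xiUp a b x k k' =
      2 * (v 0 * oM a b o x 1 - v 1 * oM a b o x 0) := by
  simp [Fin.sum_univ_two, lo_zero, lo_one, xiUp, xiLow, oM, quadM, eps]
  ring

lemma hasDerivAt_oM (a b : Fin 2 → Fin 2 → ℂ) (o : Fin 2 → ℂ) (x : Sp) (k k' i' : Fin 2) :
    HasDerivAt (fun t => oM a b o (coordLine x k k' t) i')
      (if i' = k' then o 0 * a 1 k - o 1 * a 0 k else 0) 0 := by
  refine (((hasDerivAt_quadM a b x k k' 1 i').const_mul (o 0)).fun_sub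
    ((hasDerivAt_quadM a b x k k' 0 i').const_mul (o 1))).congr_deriv ?_
  split_ifs <;> simp

/-- The algebraic content of the zero-rest-mass equation: `A`, `B` are the spinors factorising `K`,
`p`, `r` and `q`, `s` their derivatives in the directions `(k, 1)` and `(k, 0)`, and `M`, `w`, `g`
are the values of `M_k`, `o_i ε^{ij} M_j` and `o_i ε^{ij} a_{jk}`. -/
lemma massless_identity {A B p r q s M : Fin 2 → ℂ} (w : Fin 2 → ℂ) (g : ℂ)
    (hD : A 0 * B 1 - A 1 * B 0 ≠ 0)
    (p00 : p 0 * B 0 + A 0 * r 0 = 0)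
    (p01 : p 0 * B 1 + A 0 * r 1 + (p 1 * B 0 + A 1 * r 0) = 2 * M 0)
    (p11 : p 1 * B 1 + A 1 * r 1 = 2 * M 1)
    (q00 : q 0 * B 0 + A 0 * s 0 = 2 * M 0)
    (q01 : q 0 * B 1 + A 0 * s 1 + (q 1 * B 0 + A 1 * s 0) = 2 * M 1)
    (q11 : q 1 * B 1 + A 1 * s 1 = 0) (i : Fin 2) :
    (A 0 * B 1 - A 1 * B 0) * (A 0 * w 1 - A 1 * w 0) *
      ((p 1 * A i + A 1 * p i) + (q 0 * A i + A 0 * q i)) -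
    A i * (A 0 * w 1 - A 1 * w 0) * (A 1 * (p 0 * B 1 + A 0 * r 1 - (p 1 * B 0 + A 1 * r 0)) +
      A 0 * (q 0 * B 1 + A 0 * s 1 - (q 1 * B 0 + A 1 * s 0))) -
    2 * A i * (A 0 * B 1 - A 1 * B 0) * (A 1 * (p 0 * w 1 + A 0 * g - p 1 * w 0) +
      A 0 * (q 0 * w 1 - (q 1 * w 0 + A 1 * g))) = 0 := by
  have hXp : (A 0 * B 1 - A 1 * B 0) * (A 0 * p 1 - A 1 * p 0) =
      2 * A 0 * (A 0 * M 1 - A 1 * M 0) := by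
    linear_combination A 0 ^ 2 * p11 - A 0 * A 1 * p01 + A 1 ^ 2 * p00
  have hXq : (A 0 * B 1 - A 1 * B 0) * (A 0 * q 1 - A 1 * q 0) =
      -2 * A 1 * (A 0 * M 1 - A 1 * M 0) := by
    linear_combination A 0 ^ 2 * q11 - A 0 * A 1 * q01 + A 1 ^ 2 * q00
  have hX : A 1 * (A 0 * p 1 - A 1 * p 0) + A 0 * (A 0 * q 1 - A 1 * q 0) = 0 := by
    refine mul_left_cancel₀ hD ?_
    linear_combination A 1 * hXp + A 0 * hXq
  have hXB : (A 0 * p 1 - A 1 * p 0) * B 1 + (A 0 * q 1 - A 1 * q 0) * B 0 =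
      2 * (A 0 * M 1 - A 1 * M 0) := by
    refine mul_left_cancel₀ hD ?_
    linear_combination B 1 * hXp + B 0 * hXq
  have hdD : A 1 * (p 0 * B 1 + A 0 * r 1 - (p 1 * B 0 + A 1 * r 0)) +
      A 0 * (q 0 * B 1 + A 0 * s 1 - (q 1 * B 0 + A 1 * s 0)) =
      2 * (A 0 * M 1 - A 1 * M 0) := by
    refine mul_left_cancel₀ hD ?_
    linear_combination
      A 1 * (-2 * A 0 * B 0 * p11 + (A 0 * B 1 + A 1 * B 0) * p01 - 2 * A 1 * B 1 * p00) +
      A 0 * (-2 * A 0 * B 0 * q11 + (A 0 * B 1 + A 1 * B 0) * q01 - 2 * A 1 * B 1 * q00)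
  have hpq : ∀ j, (A 0 * B 1 - A 1 * B 0) * (A 1 * p j + A 0 * q j) =
      -(A 1 * (B 0 * p 1 - B 1 * p 0) + A 0 * (B 0 * q 1 - B 1 * q 0)) * A j := by
    rw [Fin.forall_fin_two]
    constructor
    · linear_combination B 0 * hX
    · linear_combination B 1 * hX
  have hdiv : (A 0 * B 1 - A 1 * B 0) * (p 1 + q 0) = 2 * (A 0 * M 1 - A 1 * M 0) -
      (A 1 * (B 0 * p 1 - B 1 * p 0) + A 0 * (B 0 * q 1 - B 1 * q 0)) := by
    linear_combination hXB
  linear_combination (A 0 * w 1 - A 1 * w 0) * A i * hdiv + (A 0 * w 1 - A 1 * w 0) * hpq i -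
    A i * (A 0 * w 1 - A 1 * w 0) * hdD - 2 * A i * w 1 * hpq 0 + 2 * A i * w 0 * hpq 1

/-- The quotient rule for functions of the shape of `φ`. -/
lemma hasDerivAt_quotient {u v D W : ℂ → ℂ} {du dv dD dW : ℂ} {t : ℂ} (m : ℂ)
    (hu : HasDerivAt u du t) (hv : HasDerivAt v dv t) (hD : HasDerivAt D dD t)
    (hW : HasDerivAt W dW t) (hD0 : D t ≠ 0) (hW0 : W t ≠ 0) :
    HasDerivAt (fun τ => m * u τ * v τ / (D τ * (2 * W τ) ^ 2))
      (m * (D t * W t * (du * v t + u t * dv) - u t * v t * W t * dD - 2 * u t * v t * D t * dW) /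
        (4 * D t ^ 2 * W t ^ 3)) t := by
  refine (((hu.const_mul m).fun_mul hv).fun_div (hD.fun_mul ((hW.const_mul 2).fun_pow 2))
    (by simp [hD0, hW0])).congr_deriv ?_
  field_simp
  ring

theorem stmt9 (a b c : Fin 2 → Fin 2 → ℂ)
    (ha : ∀ i j, a i j = a j i) (hc : ∀ i' j', c i' j' = c j' i')
    (o : Fin 2 → ℂ) (ho : o ≠ 0) (κ : ℂ)
    (U : Set Sp) (hU : IsOpen U)
    (αf βf : Sp → Fin 2 → ℂ)
    (hαd : DifferentiableOn ℂ αf U) (hβd : DifferentiableOn ℂ βf U)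
    (hK : ∀ x ∈ U, ∀ (i' j' : Fin 2), Kup a b c x i' j' =
        (1/2) * (αf x i' * βf x j' + αf x j' * βf x i'))
    (hαβ : ∀ x ∈ U, (∑ k', lo (αf x) k' * βf x k') ≠ 0)
    (hoξ : ∀ x ∈ U, (∑ k, ∑ k', o k * lo (αf x) k' * xiUp a b x k k') ≠ 0) :
    (∀ x ∈ U, ∀ (k j' : Fin 2),
        (∑ i', ∑ k', eps i' k' *
          pd k k' (fun y => phiF a b o κ αf βf y i' j') x) = 0) ∧
    (∀ x ∈ U,
        (∑ i', ∑ j', (∑ k', ∑ l', eps i' k' * eps j' l' * phiF a b o κ αf βf x k' l') *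
          phiF a b o κ αf βf x i' j') = 0) := by
  refine ⟨fun x hx k j' => ?_, fun x _ => ?_⟩
  · have hxU : U ∈ nhds x := hU.mem_nhds hx
    have hα : ∀ i', DifferentiableAt ℂ (fun y => αf y i') x :=
      fun i' => differentiableAt_pi.1 (hαd.differentiableAt hxU) i'
    have hβ : ∀ i', DifferentiableAt ℂ (fun y => βf y i') x :=
      fun i' => differentiableAt_pi.1 (hβd.differentiableAt hxU) i'
    let p : Fin 2 → Fin 2 → ℂ := fun k' i' => pd k k' (fun y => αf y i') x
    let r : Fin 2 → Fin 2 → ℂ := fun k' i' => pd k k' (fun y => βf y i') x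
    have hA : ∀ k' i', HasDerivAt (fun t => αf (coordLine x k k' t) i') (p k' i') 0 :=
      fun k' i' => hasDerivAt_comp_coordLine (hα i') k k'
    have hB : ∀ k' i', HasDerivAt (fun t => βf (coordLine x k k' t) i') (r k' i') 0 :=
      fun k' i' => hasDerivAt_comp_coordLine (hβ i') k k'
    have hdK : ∀ k' i' l', (if l' = k' then quadM a b x k i' else 0) +
        (if i' = k' then quadM a b x k l' else 0) =
        (1/2) * ((p k' i' * βf x l' + αf x i' * r k' l') +
          (p k' l' * βf x i' + αf x l' * r k' i')) := by
      intro k' i' l'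
      have hnear : ∀ᶠ t in nhds (0 : ℂ), coordLine x k k' t ∈ U :=
        (hasDerivAt_coordLine x k k').continuousAt.eventually_mem
          (by rwa [coordLine_zero])
      have h := (((hA k' i').fun_mul (hB k' l')).fun_add
        ((hA k' l').fun_mul (hB k' i'))).const_mul (1/2)
      simp only [coordLine_zero] at h
      exact (hasDerivAt_Kup ha b c x k k' i' l').unique
        (h.congr_of_eventuallyEq (hnear.mono fun t ht => hK _ ht i' l'))
    have hD0 := hαβ x hx
    have hW0 := hoξ x hx
    rw [sum_lo_mul] at hD0
    rw [sum_o_lo_xiUp] at hW0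
    replace hW0 := right_ne_zero_of_mul hW0
    have hl : ∀ k' i', HasDerivAt (fun t => lo (αf (coordLine x k k' t)) i')
        (lo (p k') i') 0 := by
      intro k' i'
      simp only [lo]
      exact HasDerivAt.fun_sum fun n _ => (hA k' n).mul_const _
    have hφ : ∀ i', DifferentiableAt ℂ (fun y => phiF a b o κ αf βf y i' j') x := by
      intro i'
      have hden := mul_ne_zero (hαβ x hx) (pow_ne_zero 2 (hoξ x hx))
      rw [sum_lo_mul, sum_o_lo_xiUp] at hden
      simp only [phiF, sum_lo_mul, sum_o_lo_xiUp]
      simp only [lo, oM, quadM, Fin.sum_univ_two] at hden ⊢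
      fun_prop (disch := exact hden)
    have hpd : ∀ k' i', pd k k' (fun y => phiF a b o κ αf βf y i' j') x =
        -I * κ * ((αf x 0 * βf x 1 - αf x 1 * βf x 0) *
          (αf x 0 * oM a b o x 1 - αf x 1 * oM a b o x 0) *
          (lo (p k') i' * lo (αf x) j' + lo (αf x) i' * lo (p k') j') -
          lo (αf x) i' * lo (αf x) j' * (αf x 0 * oM a b o x 1 - αf x 1 * oM a b o x 0) *
            (p k' 0 * βf x 1 + αf x 0 * r k' 1 - (p k' 1 * βf x 0 + αf x 1 * r k' 0)) -
          2 * lo (αf x) i' * lo (αf x) j' * (αf x 0 * βf x 1 - αf x 1 * βf x 0) *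
            (p k' 0 * oM a b o x 1 +
                αf x 0 * (if 1 = k' then o 0 * a 1 k - o 1 * a 0 k else 0) -
              (p k' 1 * oM a b o x 0 +
                αf x 1 * (if 0 = k' then o 0 * a 1 k - o 1 * a 0 k else 0)))) /
        (4 * (αf x 0 * βf x 1 - αf x 1 * βf x 0) ^ 2 *
          (αf x 0 * oM a b o x 1 - αf x 1 * oM a b o x 0) ^ 3) := by
      intro k' i'
      have hD := ((hA k' 0).fun_mul (hB k' 1)).fun_sub ((hA k' 1).fun_mul (hB k' 0))
      have hW := ((hA k' 0).fun_mul (hasDerivAt_oM a b o x k k' 1)).fun_sub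
        ((hA k' 1).fun_mul (hasDerivAt_oM a b o x k k' 0))
      have h := hasDerivAt_quotient (-I * κ) (hl k' i') (hl k' j') hD hW
        (by simpa only [coordLine_zero] using hD0) (by simpa only [coordLine_zero] using hW0)
      simp only [coordLine_zero] at h
      have h' := hasDerivAt_comp_coordLine (hφ i') k k'
      simp only [phiF, sum_lo_mul, sum_o_lo_xiUp] at h' ⊢
      exact h'.unique h
    have e := fun (k' i' l' : Fin 2) => (hdK k' i' l').symm
    have hN := massless_identity (p := p 1) (q := p 0) (r := r 1) (s := r 0)
      (M := quadM a b x k) (oM a b o x) (o 0 * a 1 k - o 1 * a 0 k) hD0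
      (by simpa using e 1 0 0)
      (by have := e 1 0 1; simp at this; linear_combination 2 * this)
      (by have := e 1 1 1; simp at this; linear_combination this)
      (by have := e 0 0 0; simp at this; linear_combination this)
      (by have := e 0 0 1; simp at this; linear_combination 2 * this)
      (by simpa using e 0 1 1)
    simp only [Fin.sum_univ_two, hpd]
    generalize (4 * (αf x 0 * βf x 1 - αf x 1 * βf x 0) ^ 2 *
      (αf x 0 * oM a b o x 1 - αf x 1 * oM a b o x 0) ^ 3) = den
    revert j'
    rw [Fin.forall_fin_two]
    constructor
    · intros
      simp [eps, lo_zero, lo_one]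
      linear_combination (-I * κ / den) * hN 1
    · intros
      simp [eps, lo_zero, lo_one]
      linear_combination (I * κ / den) * hN 0
  · simp [Fin.sum_univ_two, phiF, eps]
    ring
end
end

section
/- Let o = (o_α) and ι = (ι_α) be constant spinors with ι^α o_α = 1, and let φ = (φ_{α̇β̇}) be a symmetric complex 2×2 array which is null: φ^{α̇β̇} φ_{α̇β̇} = 0, where φ^{α̇β̇} = ε^{α̇γ̇}ε^{β̇δ̇}φ_{γ̇δ̇}. Define the Kerr–Schild metric g_{αα̇ββ̇} := ε_{αβ}ε_{α̇β̇} + o_α o_β φ_{α̇β̇} and the array ǧ^{αα̇ββ̇} := ε^{αβ}ε^{α̇β̇} − o^α o^β φ^{α̇β̇}; define the two-forms ω¹_{αα̇ββ̇} := i(o_α o_β − ι_α ι_β)ε_{α̇β̇}, ω²_{αα̇ββ̇} := (o_α o_β + ι_α ι_β)ε_{α̇β̇}, ω³_{αα̇ββ̇} := i(o_α ι_β + ι_α o_β)ε_{α̇β̇}, and Ω¹ := ω¹ + (i/2)φ_{α̇β̇}ε_{αβ}, Ω² := ω² − (1/2)φ_{α̇β̇}ε_{αβ}, Ω³ := ω³;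 and define ε_{αα̇ββ̇γγ̇δδ̇} := ε_{αγ}ε_{βδ}ε_{α̇δ̇}ε_{β̇γ̇} − ε_{αδ}ε_{βγ}ε_{α̇γ̇}ε_{β̇δ̇}. Then: (i) ǧ is the inverse of g, i.e. ǧ^{αα̇γγ̇} g_{γγ̇ββ̇} = δ^α_β δ^{α̇}_{β̇}; and (ii) each Ωⁱ (i = 1,2,3) is anti-self-dual with respect to g: (1/2) ε_{αα̇ββ̇γγ̇δδ̇} ǧ^{γγ̇εε̇} ǧ^{δδ̇ζζ̇} Ωⁱ_{εε̇ζζ̇} = −Ωⁱ_{αα̇ββ̇}. -/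
noncomputable section

open Complex

/-- For a null symmetric `φ` and a symmetric `S` with `S_{αβ} o^α o^β = -2c`, the two-form
`S_{αβ} ε_{α̇β̇} + c φ_{α̇β̇} ε_{αβ}` is anti-self-dual with respect to the Kerr–Schild metric
`ε_{αβ} ε_{α̇β̇} + o_α o_β φ_{α̇β̇}`. -/
lemma kerrSchild_antiSelfDual (o : Fin 2 → ℂ) (φ S : Fin 2 → Fin 2 → ℂ) (c : ℂ)
    (hsym : φ 1 0 = φ 0 1) (hnull : φ 0 0 * φ 1 1 - φ 0 1 ^ 2 = 0) (hS : S 1 0 = S 0 1)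
    (hc : S 0 0 * o 1 ^ 2 - 2 * S 0 1 * o 0 * o 1 + S 1 1 * o 0 ^ 2 = -2 * c)
    (gInv Om : Fin 2 → Fin 2 → Fin 2 → Fin 2 → ℂ)
    (hg : ∀ i i' j j', gInv i i' j j' = eps i j * eps i' j' -
      (∑ k, eps i k * o k) * (∑ k, eps j k * o k) *
        ∑ k', ∑ l', eps i' k' * eps j' l' * φ k' l')
    (hOm : ∀ i i' j j', Om i i' j j' = S i j * eps i' j' + c * φ i' j' * eps i j)
    (i i' j j' : Fin 2) :
    (1/2) * (∑ k, ∑ k', ∑ l, ∑ l', ∑ m, ∑ m', ∑ n, ∑ n',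
      (eps i k * eps j l * eps i' l' * eps j' k' - eps i l * eps j k * eps i' k' * eps j' l') *
        gInv k k' m m' * gInv l l' n n' * Om m m' n n') = -Om i i' j j' := by
  obtain rfl : c = -(S 0 0 * o 1 ^ 2 - 2 * S 0 1 * o 0 * o 1 + S 1 1 * o 0 ^ 2) / 2 := by
    linear_combination hc / 2
  have h00 : eps 0 0 = 0 := by simp [eps]
  have h01 : eps 0 1 = 1 := by simp [eps]
  have h10 : eps 1 0 = -1 := by simp [eps]
  have h11 : eps 1 1 = 0 := by simp [eps]
  revert i i' j j'
  simp only [Fin.forall_fin_two, Fin.sum_univ_two, h00, h01, h10, h11, mul_zero, zero_mul, add_zero,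
    zero_add, sub_zero, zero_sub, mul_one, one_mul, sub_self, hg, hOm, hsym, hS]
  refine ⟨⟨⟨⟨?_, ?_⟩, ?_, ?_⟩, ⟨?_, ?_⟩, ?_, ?_⟩, ⟨⟨?_, ?_⟩, ?_, ?_⟩, ⟨?_, ?_⟩, ?_, ?_⟩ <;> grind

theorem stmt10 (o ι : Fin 2 → ℂ)
    (hoι : (∑ i, (∑ j, eps i j * ι j) * o i) = 1)
    (φ : Fin 2 → Fin 2 → ℂ) (hsym : ∀ i' j', φ i' j' = φ j' i')
    (hnull : (∑ i', ∑ j',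
        (∑ k', ∑ l', eps i' k' * eps j' l' * φ k' l') * φ i' j') = 0) :
    let g : Fin 2 → Fin 2 → Fin 2 → Fin 2 → ℂ := fun i i' j j' =>
      eps i j * eps i' j' + o i * o j * φ i' j'
    let oU : Fin 2 → ℂ := fun i => ∑ j, eps i j * o j
    let φU : Fin 2 → Fin 2 → ℂ := fun i' j' => ∑ k', ∑ l', eps i' k' * eps j' l' * φ k' l'
    let gInv : Fin 2 → Fin 2 → Fin 2 → Fin 2 → ℂ := fun i i' j j' =>
      eps i j * eps i' j' - oU i * oU j * φU i' j'
    let Om1 : Fin 2 → Fin 2 → Fin 2 → Fin 2 → ℂ := fun i i' j j' =>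
      I * (o i * o j - ι i * ι j) * eps i' j' + (I/2) * φ i' j' * eps i j
    let Om2 : Fin 2 → Fin 2 → Fin 2 → Fin 2 → ℂ := fun i i' j j' =>
      (o i * o j + ι i * ι j) * eps i' j' - (1/2) * φ i' j' * eps i j
    let Om3 : Fin 2 → Fin 2 → Fin 2 → Fin 2 → ℂ := fun i i' j j' =>
      I * (o i * ι j + ι i * o j) * eps i' j'
    let eps8 : Fin 2 → Fin 2 → Fin 2 → Fin 2 → Fin 2 → Fin 2 → Fin 2 → Fin 2 → ℂ :=
      fun i i' j j' k k' l l' =>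
        eps i k * eps j l * eps i' l' * eps j' k' - eps i l * eps j k * eps i' k' * eps j' l'
    let ASD : (Fin 2 → Fin 2 → Fin 2 → Fin 2 → ℂ) → Prop := fun Om =>
      ∀ i i' j j',
        (1/2) * (∑ k, ∑ k', ∑ l, ∑ l', ∑ m, ∑ m', ∑ n, ∑ n',
            eps8 i i' j j' k k' l l' * gInv k k' m m' * gInv l l' n n' * Om m m' n n')
          = -Om i i' j j'
    (∀ i i' j j', (∑ k, ∑ k', gInv i i' k k' * g k k' j j') =
        (if i = j then (1 : ℂ) else 0) * (if i' = j' then 1 else 0)) ∧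
    ASD Om1 ∧ ASD Om2 ∧ ASD Om3 := by
  have h00 : eps 0 0 = 0 := by simp [eps]
  have h01 : eps 0 1 = 1 := by simp [eps]
  have h10 : eps 1 0 = -1 := by simp [eps]
  have h11 : eps 1 1 = 0 := by simp [eps]
  have hs : φ 1 0 = φ 0 1 := hsym 1 0
  simp only [Fin.sum_univ_two, h00, h01, h10, h11, hs] at hoι hnull
  have hn : φ 0 0 * φ 1 1 - φ 0 1 ^ 2 = 0 := by linear_combination hnull / 2
  intro g oU φU gInv Om1 Om2 Om3 eps8 ASD
  refine ⟨?_, ?_, ?_, ?_⟩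
  · simp only [g, gInv, oU, φU, Fin.forall_fin_two, Fin.sum_univ_two, h00, h01, h10, h11, hs]
    refine ⟨⟨⟨⟨?_, ?_⟩, ?_, ?_⟩, ⟨?_, ?_⟩, ?_, ?_⟩, ⟨⟨?_, ?_⟩, ?_, ?_⟩, ⟨?_, ?_⟩, ?_, ?_⟩ <;>
      simp <;> grind
  · refine kerrSchild_antiSelfDual o φ (fun i j => I * (o i * o j - ι i * ι j)) (I / 2) hs hn
      (by ring) ?_ gInv Om1 (fun _ _ _ _ => rfl) (fun _ _ _ _ => rfl)
    linear_combination (-I * (ι 1 * o 0 - ι 0 * o 1 + 1)) * hoι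
  · refine kerrSchild_antiSelfDual o φ (fun i j => o i * o j + ι i * ι j) (-(1 / 2)) hs hn
      (by ring) ?_ gInv Om2 (fun _ _ _ _ => rfl) (fun _ _ _ _ => by simp only [Om2]; ring)
    linear_combination (ι 1 * o 0 - ι 0 * o 1 + 1) * hoι
  · exact kerrSchild_antiSelfDual o φ (fun i j => I * (o i * ι j + ι i * o j)) 0 hs hn
      (by ring) (by ring) gInv Om3 (fun _ _ _ _ => rfl) (fun _ _ _ _ => by simp only [Om3]; ring)
end
end

section
/- Let X, Y, Z, κ, a, Z₀, R be complex numbers with a ≠ 0, R ≠ 0, R² = X² + Y² + Z², and Z₀² = −κ/(16a³). Define 𝒳 := X + (κ/(32a³))·(X − iY)/R², 𝒴 := Y + (iκ/(32a³))·(X − iY)/R², 𝒵 := Z, and ℛ_± := R ± Z₀·Z/R. Then: (i) 𝒳 + i𝒴 = X + iY; (ii) for each sign, 𝒳² + 𝒴² + (𝒵 ± Z₀)² = ℛ_±²; and (iii) if ℛ_+ ≠ 0, ℛ_− ≠ 0 and R⁴ − Z₀²Z² ≠ 0, then R³/(2(R⁴ + (κ/(16a³))·Z²)) = (1/4)·(1/ℛ_+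 + 1/ℛ_−). -/
open Complex

/-- The norm identity for the shifted coordinates, with the shift expressed through
`W ^ 2`. -/
theorem shifted_norm_sq {X Y Z W R : ℂ} (hR : R ≠ 0) (hR2 : R ^ 2 = X ^ 2 + Y ^ 2 + Z ^ 2) :
    (X + -W ^ 2 / 2 * (X - I * Y) / R ^ 2) ^ 2 + (Y + I * (-W ^ 2 / 2) * (X - I * Y) / R ^ 2) ^ 2
      + (Z + W) ^ 2 = (R + W * Z / R) ^ 2 := by
  set u := (X - I * Y) / R ^ 2 with hu
  have hXY : (X + I * Y) * u = 1 - Z ^ 2 / R ^ 2 := by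
    rw [hu]
    field_simp
    linear_combination -hR2 - Y ^ 2 * I_sq
  have hW : (R + W * Z / R) ^ 2 = R ^ 2 + 2 * W * Z + W ^ 2 * (Z ^ 2 / R ^ 2) := by
    field_simp
    ring
  rw [hW, mul_div_assoc, mul_div_assoc, ← hu]
  linear_combination -hR2 - W ^ 2 * hXY + W ^ 4 / 4 * u ^ 2 * I_sq

theorem stmt15 (X Y Z κ a Z₀ R : ℂ) (ha : a ≠ 0) (hR : R ≠ 0)
    (hR2 : R^2 = X^2 + Y^2 + Z^2) (hZ₀ : Z₀^2 = -κ/(16*a^3)) :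
    let cX := X + (κ/(32*a^3)) * (X - I*Y)/R^2
    let cY := Y + (I*κ/(32*a^3)) * (X - I*Y)/R^2
    let cZ := Z
    let Rp := R + Z₀*Z/R
    let Rm := R - Z₀*Z/R
    (cX + I*cY = X + I*Y) ∧
      (cX^2 + cY^2 + (cZ + Z₀)^2 = Rp^2) ∧
      (cX^2 + cY^2 + (cZ - Z₀)^2 = Rm^2) ∧
      (Rp ≠ 0 → Rm ≠ 0 → R^4 - Z₀^2*Z^2 ≠ 0 →
        R^3/(2*(R^4 + (κ/(16*a^3))*Z^2)) = (1/4)*(1/Rp + 1/Rm)) := by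
  intro cX cY cZ Rp Rm
  have hκ : κ / (32 * a ^ 3) = -Z₀ ^ 2 / 2 := by
    rw [hZ₀]
    field_simp
    ring
  have hκ' : κ / (16 * a ^ 3) = -Z₀ ^ 2 := by
    rw [hZ₀]
    ring
  have hX : cX = X + -Z₀ ^ 2 / 2 * (X - I * Y) / R ^ 2 := by
    simp only [cX, hκ]
  have hY : cY = Y + I * (-Z₀ ^ 2 / 2) * (X - I * Y) / R ^ 2 := by
    simp only [cY, mul_div_assoc I κ, hκ]
  refine ⟨?_, ?_, ?_, fun hp hm _ => ?_⟩
  · rw [hX, hY]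
    linear_combination (-Z₀ ^ 2 / 2 * (X - I * Y) / R ^ 2) * I_sq
  · rw [hX, hY]
    exact shifted_norm_sq hR hR2
  · rw [hX, hY]
    have := shifted_norm_sq (W := -Z₀) hR hR2
    simpa only [neg_sq, neg_mul, neg_div, ← sub_eq_add_neg] using this
  · have hden : R ^ 4 + κ / (16 * a ^ 3) * Z ^ 2 = R ^ 2 * (Rp * Rm) := by
      rw [hκ']
      simp only [Rp, Rm]
      field_simp
      ring
    have hsum : Rp + Rm = 2 * R := by
      simp only [Rp, Rm]
      ring
    rw [hden]
    field_simp
    linear_combination -2 * hsum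
end

section
/- Let a, c, κ ∈ ℂ with a ≠ 0 and c ≠ 0, let U ⊆ ℂ⁴ be open with coordinates (u, v, w, w̃), and let ζ : U → ℂ be holomorphic and satisfy the quadratic equation a·w·v·ζ² + (a(uv + ww̃) − c)·ζ + a·u·w̃ = 0 on U. Set S := c − a(uv + ww̃) − 2a·w·v·ζ and suppose S ≠ 0 and u + ζw ≠ 0 throughout U. Then: (i) a·(w̃ + ζv)·(u + ζw) = c·ζ on U; and (ii) the function G := (iκ/(8a²c))·(w̃ + ζv)/(u + ζw) has partial derivatives ∂G/∂u = iκ·(ζv − w̃)/(8a²·S·(u + ζw)²), ∂G/∂v = iκ·ζ·(u − ζw)/(8a²·S·(u + ζw)²), ∂G/∂w = iκ·ζ·(ζv − w̃)/(8a²·S·(u + ζw)²), and ∂G/∂w̃ = iκ·(u − ζw)/(8a²·S·(u + ζw)²). -/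
open Complex

open Filter Topology

/-- Derivative, along a curve `(u, v, w, x)`, of the quotient `(x + z v) / (u + z w)` when
`z` solves `a (x + z v) (u + z w) = c z` along the curve. -/
theorem hasDerivAt_quotient_of_quadratic {a c t : ℂ} {u v w x z : ℂ → ℂ}
    {u' v' w' x' z' : ℂ} (hc : c ≠ 0)
    (hu : HasDerivAt u u' t) (hv : HasDerivAt v v' t) (hw : HasDerivAt w w' t)
    (hx : HasDerivAt x x' t) (hz : HasDerivAt z z' t)
    (heq : ∀ᶠ s in 𝓝 t, a * (x s + z s * v s) * (u s + z s * w s) = c * z s)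
    (hS : c - a * (u t * v t + w t * x t) - 2 * a * w t * v t * z t ≠ 0)
    (hD : u t + z t * w t ≠ 0) (k : ℂ) :
    HasDerivAt (fun s => k / c * (x s + z s * v s) / (u s + z s * w s))
      (k * ((z t * v t - x t) * (u' + z t * w') + (u t - z t * w t) * (x' + z t * v')) /
        ((c - a * (u t * v t + w t * x t) - 2 * a * w t * v t * z t) *
          (u t + z t * w t) ^ 2)) t := by
  have hN := hx.fun_add (hz.fun_mul hv)
  have hM := hu.fun_add (hz.fun_mul hw)
  have hrel := (((hN.const_mul a).fun_mul hM).congr_of_eventuallyEq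
    (heq.mono fun s hs => hs.symm)).unique (hz.const_mul c)
  have h0 := heq.self_of_nhds
  refine ((hN.const_mul (k / c)).fun_div hM hD).congr_deriv ?_
  have key : (c - a * (u t * v t + w t * x t) - 2 * a * w t * v t * z t) *
      ((x' + (z' * v t + z t * v')) * (u t + z t * w t) -
        (x t + z t * v t) * (u' + (z' * w t + z t * w'))) =
      c * ((z t * v t - x t) * (u' + z t * w') + (u t - z t * w t) * (x' + z t * v')) := by
    linear_combination (-(v t * (u t + z t * w t) - w t * (x t + z t * v t))) * hrel +
      2 * (v t * (u' + z t * w') - w t * (x' + z t * v')) * h0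
  rw [div_eq_div_iff (pow_ne_zero 2 hD) (mul_ne_zero hS (pow_ne_zero 2 hD))]
  field_simp
  linear_combination k * key

theorem stmt16 (a c κ : ℂ) (ha : a ≠ 0) (hc : c ≠ 0)
    (U : Set (ℂ × ℂ × ℂ × ℂ)) (hU : IsOpen U)
    (ζ : ℂ × ℂ × ℂ × ℂ → ℂ) (hζd : DifferentiableOn ℂ ζ U)
    (hζ : ∀ p ∈ U, a * p.2.2.1 * p.2.1 * (ζ p)^2 +
        (a*(p.1*p.2.1 + p.2.2.1*p.2.2.2) - c) * ζ p + a * p.1 * p.2.2.2 = 0)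
    (hS : ∀ p ∈ U,
        c - a*(p.1*p.2.1 + p.2.2.1*p.2.2.2) - 2*a*p.2.2.1*p.2.1*ζ p ≠ 0)
    (hden : ∀ p ∈ U, p.1 + ζ p * p.2.2.1 ≠ 0) :
    let G : ℂ × ℂ × ℂ × ℂ → ℂ := fun p =>
      (I*κ/(8*a^2*c)) * (p.2.2.2 + ζ p * p.2.1) / (p.1 + ζ p * p.2.2.1)
    (∀ p ∈ U, a * (p.2.2.2 + ζ p * p.2.1) * (p.1 + ζ p * p.2.2.1) = c * ζ p) ∧
    (∀ p ∈ U,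
      let u := p.1
      let v := p.2.1
      let w := p.2.2.1
      let w' := p.2.2.2
      let S := c - a*(u*v + w*w') - 2*a*w*v*ζ p
      HasDerivAt (fun t => G (t, v, w, w'))
          (I*κ*(ζ p * v - w')/(8*a^2*S*(u + ζ p * w)^2)) u ∧
        HasDerivAt (fun t => G (u, t, w, w'))
          (I*κ*(ζ p)*(u - ζ p * w)/(8*a^2*S*(u + ζ p * w)^2)) v ∧
        HasDerivAt (fun t => G (u, v, t, w'))
          (I*κ*(ζ p)*(ζ p * v - w')/(8*a^2*S*(u + ζ p * w)^2)) w ∧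
        HasDerivAt (fun t => G (u, v, w, t))
          (I*κ*(u - ζ p * w)/(8*a^2*S*(u + ζ p * w)^2)) w') := by
  intro G
  have hprod : ∀ p ∈ U,
      a * (p.2.2.2 + ζ p * p.2.1) * (p.1 + ζ p * p.2.2.1) = c * ζ p := fun p hp => by
    linear_combination hζ p hp
  refine ⟨hprod, ?_⟩
  rintro ⟨u, v, w, x⟩ hp
  have hcurve : ∀ {γ : ℂ → ℂ × ℂ × ℂ × ℂ} {t u' v' w' x' : ℂ}, γ t = (u, v, w, x) →
      HasDerivAt (fun s => (γ s).1) u' t → HasDerivAt (fun s => (γ s).2.1) v' t →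
      HasDerivAt (fun s => (γ s).2.2.1) w' t → HasDerivAt (fun s => (γ s).2.2.2) x' t →
      HasDerivAt (fun s => G (γ s))
        (I * κ / (8 * a ^ 2) * ((ζ (u, v, w, x) * v - x) * (u' + ζ (u, v, w, x) * w') +
          (u - ζ (u, v, w, x) * w) * (x' + ζ (u, v, w, x) * v')) /
          ((c - a * (u * v + w * x) - 2 * a * w * v * ζ (u, v, w, x)) *
            (u + ζ (u, v, w, x) * w) ^ 2)) t := by
    intro γ t u' v' w' x' hγ hu hv hw hx
    have hd : HasDerivAt γ (u', v', w', x') t := hu.prodMk (hv.prodMk (hw.prodMk hx))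
    have hmem : U ∈ 𝓝 (γ t) := hU.mem_nhds (hγ ▸ hp)
    have hz := (((hζd.differentiableAt hmem).comp t hd.differentiableAt)).hasDerivAt
    have key := hasDerivAt_quotient_of_quadratic hc hu hv hw hx hz
      ((hd.continuousAt.eventually_mem hmem).mono fun s hs => hprod _ hs)
      (hS _ (hγ ▸ hp)) (hden _ (hγ ▸ hp)) (I * κ / (8 * a ^ 2))
    simpa only [Function.comp_apply, hγ, div_div] using key
  have h1 := hS _ hp
  have h2 := hden _ hp
  dsimp only at h1 h2 ⊢
  refine ⟨?_, ?_, ?_, ?_⟩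
  · refine (hcurve (γ := fun t => (t, v, w, x)) rfl (hasDerivAt_id' u) (hasDerivAt_const _ _)
      (hasDerivAt_const _ _) (hasDerivAt_const _ _)).congr_deriv ?_
    field_simp
    ring
  · refine (hcurve (γ := fun t => (u, t, w, x)) rfl (hasDerivAt_const _ _) (hasDerivAt_id' v)
      (hasDerivAt_const _ _) (hasDerivAt_const _ _)).congr_deriv ?_
    field_simp
    ring
  · refine (hcurve (γ := fun t => (u, v, t, x)) rfl (hasDerivAt_const _ _)
      (hasDerivAt_const _ _) (hasDerivAt_id' w) (hasDerivAt_const _ _)).congr_deriv ?_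
    field_simp
    ring
  · refine (hcurve (γ := fun t => (u, v, w, t)) rfl (hasDerivAt_const _ _)
      (hasDerivAt_const _ _) (hasDerivAt_const _ _) (hasDerivAt_id' x)).congr_deriv ?_
    field_simp
    ring
end

section
/- Let a, c, ε, X, Y, Z, R, P be complex numbers with a ≠ 0, c ≠ 0, X + iY ≠ 0, R² = X² + Y² + Z², and P² = X² + Y² + (Z − c/a)², and set κ := 4a(c² − ε²). Define 𝒳 := X − (κ/(16ac²))·[X² + Y² + Z(Z − c/a) − R·P]/(X + iY), 𝒴 := Y − (iκ/(16ac²))·[X² + Y² + Z(Z − c/a) − R·P]/(X + iY), and 𝒵 := Z. Then 𝒳 + i𝒴 = X + iY, and for each sign: 𝒳² + 𝒴² + (𝒵 − (c ∓ ε)/(2a))² = ( (1/2)·[(P + R) ∓ (ε/c)(P − R)] )². -/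
open Complex

/-- The two-centre identity in terms of `d = c / a`, `e = ε / c` and the shift `q`. -/
theorem two_centre_distance_sq {d e s q X Y Z R P : ℂ}
    (hR : R^2 = X^2 + Y^2 + Z^2) (hP : P^2 = X^2 + Y^2 + (Z - d)^2) (hs : s^2 = 1)
    (hq : q * (X + I*Y) = (1 - e^2)/4 * (X^2 + Y^2 + Z*(Z - d) - R*P)) :
    (X - q)^2 + (Y - I*q)^2 + (Z - (d - s*(e*d))/2)^2
      = ((1/2)*((P + R) - s*e*(P - R)))^2 := by
  linear_combination (-2)*hq - (1 + e^2 - 2*s*e)/4*hP - (1 + e^2 + 2*s*e)/4*hR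
    + (e^2*d^2 - e^2*(P - R)^2)/4*hs + q^2*I_sq

theorem stmt18 (a c ε X Y Z R P : ℂ) (ha : a ≠ 0) (hc : c ≠ 0)
    (hXY : X + I*Y ≠ 0) (hR : R^2 = X^2 + Y^2 + Z^2)
    (hP : P^2 = X^2 + Y^2 + (Z - c/a)^2) :
    let κ := 4*a*(c^2 - ε^2)
    let cX := X - (κ/(16*a*c^2)) * (X^2 + Y^2 + Z*(Z - c/a) - R*P)/(X + I*Y)
    let cY := Y - (I*κ/(16*a*c^2)) * (X^2 + Y^2 + Z*(Z - c/a) - R*P)/(X + I*Y)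
    let cZ := Z
    (cX + I*cY = X + I*Y) ∧
      (∀ s : ℂ, s = 1 ∨ s = -1 →
        cX^2 + cY^2 + (cZ - (c - s*ε)/(2*a))^2
          = ((1/2)*((P + R) - s*(ε/c)*(P - R)))^2) := by
  intro κ cX cY cZ
  set q := (κ/(16*a*c^2)) * (X^2 + Y^2 + Z*(Z - c/a) - R*P)/(X + I*Y) with hq
  have hcY : cY = Y - I*q := by
    simp only [cY, hq]
    ring
  have hqW : q * (X + I*Y) = (1 - (ε/c)^2)/4 * (X^2 + Y^2 + Z*(Z - c/a) - R*P) := by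
    have hκ : κ/(16*a*c^2) = (1 - (ε/c)^2)/4 := by
      simp only [κ]
      field_simp
      ring
    rw [hq, div_mul_cancel₀ _ hXY, hκ]
  refine ⟨?_, fun s hs => ?_⟩
  · rw [hcY]
    linear_combination (-q)*I_sq
  · have hcentre : (c - s*ε)/(2*a) = (c/a - s*(ε/c*(c/a)))/2 := by
      field_simp
    rw [hcY, hcentre]
    exact two_centre_distance_sq hR hP (sq_eq_one_iff.mpr hs) hqW
end
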